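/- Let 1 ≤ k ≤ n. The function λ ↦ σ_k(λ)^{1/k} is concave on the Gårding cone Γ_k; that is, for all λ, μ ∈ Γ_k and all t ∈ [0,1], σ_k(tλ + (1−t)μ)^{1/k} ≥ t·σ_k(λ)^{1/k} + (1−t)·σ_k(μ)^{1/k}. -/

import Mathlib

/-- The `m`-th elementary symmetric polynomial of `λ ∈ ℝⁿ`. -/
noncomputable def esymm (n m : ℕ) (lam : Fin n → ℝ) : ℝ :=
  ∑ s ∈ Finset.powersetCard m (Finset.univ : Finset (Fin n)), ∏ i ∈ s, lam i

/-- The Gårding cone `Γ_k`. -/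
def GardingCone (n k : ℕ) : Set (Fin n → ℝ) :=
  {lam | ∀ j, 1 ≤ j → j ≤ k → 0 < esymm n j lam}

open Polynomial in
theorem Polynomial.Splits.derivative_real {p : ℝ[X]} (hp : p.Splits) :
    (derivative p).Splits := by
  rw [splits_iff_card_roots]
  have h₁ := hp.natDegree_eq_card_roots
  have h₂ := card_roots_le_derivative p
  have h₃ := card_roots' (derivative p)
  have h₄ := natDegree_derivative_le p
  omega

open Polynomial in
theorem Polynomial.Splits.iterate_derivative_real {p : ℝ[X]} (hp : p.Splits) (m : ℕ) :
    (derivative^[m] p).Splits := by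
  induction m with
  | zero => exact hp
  | succ m ih =>
    rw [Function.iterate_succ_apply']
    exact ih.derivative_real

open Polynomial in
theorem Polynomial.Splits.two_mul_coeff_zero_mul_coeff_two_le {p : ℝ[X]} (hp : p.Splits) :
    2 * p.coeff 0 * p.coeff 2 ≤ p.coeff 1 ^ 2 := by
  have coeff_two (p q : ℝ[X]) : (p * q).coeff 2 =
      p.coeff 0 * q.coeff 2 + p.coeff 1 * q.coeff 1 + p.coeff 2 * q.coeff 0 := by
    rw [coeff_mul, Finset.Nat.sum_antidiagonal_eq_sum_range_succ_mk]
    simp [Finset.sum_range_succ]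
  induction hp using Submonoid.closure_induction with
  | mem p hp =>
    rcases hp with ⟨a, rfl⟩ | ⟨a, rfl⟩
    · simp [coeff_C]
    · simp [coeff_C, coeff_X]
  | one => simp [coeff_one]
  | mul p q _ _ hp hq =>
    rw [mul_coeff_zero, mul_coeff_one, coeff_two]
    nlinarith [mul_le_mul_of_nonneg_left hq (sq_nonneg (p.coeff 0)),
      mul_le_mul_of_nonneg_left hp (sq_nonneg (q.coeff 0))]

namespace Finset

variable {ι : Type*}

/-- The `m`-th elementary symmetric polynomial in the variables indexed by a finset. -/
noncomputable def esymmOn (S : Finset ι) (m : ℕ) (f : ι → ℝ) : ℝ :=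
  ∑ s ∈ S.powersetCard m, ∏ i ∈ s, f i

@[simp]
theorem esymmOn_zero (S : Finset ι) (f : ι → ℝ) : S.esymmOn 0 f = 1 := by
  simp [esymmOn]

@[simp]
theorem esymmOn_empty_succ (m : ℕ) (f : ι → ℝ) : (∅ : Finset ι).esymmOn (m + 1) f = 0 := by
  unfold esymmOn
  rw [powersetCard_eq_empty.2 (by simp), sum_empty]

theorem esymmOn_insert [DecidableEq ι] {S : Finset ι} {a : ι} (ha : a ∉ S) (m : ℕ) (f : ι → ℝ) :
    (insert a S).esymmOn (m + 1) f = f a * S.esymmOn m f + S.esymmOn (m + 1) f := by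
  have hmem {s : Finset ι} (hs : s ∈ S.powersetCard m) : a ∉ s :=
    fun h ↦ ha ((mem_powersetCard.1 hs).1 h)
  unfold esymmOn
  rw [powersetCard_succ_insert ha, sum_union, sum_image, add_comm, mul_sum]
  · congr 1
    exact sum_congr rfl fun s hs ↦ prod_insert (hmem hs)
  · intro s hs t ht h
    rw [← erase_insert (hmem hs), ← erase_insert (hmem ht), h]
  · rw [disjoint_left]
    intro s hs hs'
    obtain ⟨t, -, rfl⟩ := mem_image.1 hs'
    exact ha ((mem_powersetCard.1 hs).1 (mem_insert_self a t))

theorem esymmOn_succ_eq_erase [DecidableEq ι] {S : Finset ι} {a : ι} (ha : a ∈ S) (m : ℕ) (f : ι → ℝ) :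
    S.esymmOn (m + 1) f = f a * (S.erase a).esymmOn m f + (S.erase a).esymmOn (m + 1) f := by
  rw [← esymmOn_insert (notMem_erase a S), insert_erase ha]

theorem esymmOn_one (S : Finset ι) (f : ι → ℝ) : S.esymmOn 1 f = ∑ i ∈ S, f i := by
  simp [esymmOn, powersetCard_one]

theorem sum_mul_esymmOn_erase [DecidableEq ι] (S : Finset ι) (m : ℕ) (f : ι → ℝ) :
    ∑ i ∈ S, f i * (S.erase i).esymmOn m f = (m + 1) * S.esymmOn (m + 1) f := by
  induction S using Finset.induction_on generalizing m with
  | empty => simp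
  | insert a S ha ih =>
    cases m with
    | zero => simp [esymmOn_one]
    | succ m =>
      have h : ∀ i ∈ S, f i * ((insert a S).erase i).esymmOn (m + 1) f =
          f a * (f i * (S.erase i).esymmOn m f) + f i * (S.erase i).esymmOn (m + 1) f := by
        intro i hi
        rw [erase_insert_of_ne (by rintro rfl; exact ha hi),
          esymmOn_insert (fun h ↦ ha (mem_of_mem_erase h))]
        ring
      rw [sum_insert ha, erase_insert ha, sum_congr rfl h, sum_add_distrib, ← mul_sum, ih, ih,
        esymmOn_insert ha]
      push_cast
      ring

theorem esymmOn_smul (S : Finset ι) (m : ℕ) (c : ℝ) (f : ι → ℝ) :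
    S.esymmOn m (c • f) = c ^ m * S.esymmOn m f := by
  unfold esymmOn
  rw [mul_sum]
  refine sum_congr rfl fun s hs ↦ ?_
  simp [prod_mul_distrib, (mem_powersetCard.1 hs).2]

open Polynomial in
theorem coeff_prod_one_add_C_mul_X (S : Finset ι) (f : ι → ℝ) (m : ℕ) :
    (∏ i ∈ S, (1 + C (f i) * X)).coeff m = S.esymmOn m f := by
  classical
  induction S using Finset.induction_on generalizing m with
  | empty => cases m <;> simp [coeff_one]
  | insert a S ha ih =>
    rw [prod_insert ha, add_mul, one_mul, mul_assoc, coeff_add, coeff_C_mul]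
    cases m with
    | zero => simp [ih]
    | succ m => rw [coeff_X_mul, ih, ih, esymmOn_insert ha, add_comm]

open Polynomial in
/-- A weak form of Newton's inequality, valid for variables of arbitrary sign. -/
theorem esymmOn_mul_esymmOn_le_sq (S : Finset ι) (f : ι → ℝ) (m : ℕ) :
    S.esymmOn m f * S.esymmOn (m + 2) f ≤ S.esymmOn (m + 1) f ^ 2 := by
  have hs : (∏ i ∈ S, (1 + C (f i) * X)).Splits :=
    Splits.prod fun i _ ↦ Splits.of_natDegree_le_one (by compute_degree)
  have h := (hs.iterate_derivative_real m).two_mul_coeff_zero_mul_coeff_two_le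
  simp only [coeff_iterate_derivative, coeff_prod_one_add_C_mul_X, nsmul_eq_mul] at h
  rw [zero_add, add_comm 2 m, add_comm 1 m, Nat.descFactorial_self,
    show (m + 1).descFactorial m = (m + 1).factorial by
      simpa using (Nat.factorial_mul_descFactorial (Nat.le_succ m)),
    show ((m + 2).descFactorial m : ℝ) = (m + 2) * (m + 1) * m.factorial / 2 by
      have := Nat.factorial_mul_descFactorial (show m ≤ m + 2 by omega)
      rw [Nat.add_sub_cancel_left, Nat.factorial_succ (m + 1), Nat.factorial_succ m] at this
      have := congrArg (Nat.cast (R := ℝ)) this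
      push_cast [Nat.factorial] at this
      linarith, Nat.factorial_succ] at h
  push_cast at h
  set a := S.esymmOn m f
  set b := S.esymmOn (m + 1) f
  set c := S.esymmOn (m + 2) f
  have hm : (0 : ℝ) < m.factorial := by exact_mod_cast m.factorial_pos
  have h' : ((m + 1) * (m.factorial : ℝ) ^ 2) * ((m + 2) * (a * c)) ≤
      ((m + 1) * (m.factorial : ℝ) ^ 2) * ((m + 1) * b ^ 2) := by linarith
  have h'' := le_of_mul_le_mul_left h' (by positivity)
  rcases le_total (a * c) 0 with hac | hac
  · exact hac.trans (sq_nonneg b)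
  · refine le_of_mul_le_mul_left (a := (m + 1 : ℝ)) ?_ (by positivity)
    linarith

theorem esymmOn_erase_pos [DecidableEq ι] {S : Finset ι} {k : ℕ} {f : ι → ℝ}
    (hf : ∀ j ≤ k + 1, 0 < S.esymmOn j f) {i : ι} (hi : i ∈ S) :
    ∀ j ≤ k, 0 < (S.erase i).esymmOn j f := by
  intro j hj
  induction j with
  | zero => simp
  | succ j ih =>
    by_contra! hneg
    have hpos := ih (by omega)
    have h₁ := hf (j + 1) (by omega)
    have h₂ := hf (j + 2) (by omega)
    rw [esymmOn_succ_eq_erase hi] at h₁ h₂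
    have hN := (S.erase i).esymmOn_mul_esymmOn_le_sq f j
    nlinarith [mul_pos hpos h₂, mul_nonneg h₁.le (neg_nonneg.2 hneg)]

theorem mul_div_add_superadditive {x y q r s : ℝ} (hx : 0 < x + q) (hy : 0 < y + r)
    (hs : q + r ≤ s) :
    x * q / (x + q) + y * r / (y + r) ≤ (x + y) * s / (x + y + s) := by
  have hxy : 0 < x + y + s := by linarith
  rw [div_add_div _ _ hx.ne' hy.ne', div_le_div_iff₀ (by positivity) hxy]
  have e : (x + y) * s * ((x + q) * (y + r)) - (x * q * (y + r) + (x + q) * (y * r)) *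
      (x + y + s) = (x * (y + r) - y * (x + q)) ^ 2 +
      (s - q - r) * (x ^ 2 * (y + r) + y ^ 2 * (x + q)) := by ring
  have : 0 ≤ (s - q - r) * (x ^ 2 * (y + r) + y ^ 2 * (x + q)) :=
    mul_nonneg (by linarith) (by positivity)
  nlinarith [sq_nonneg (x * (y + r) - y * (x + q))]

theorem esymmOn_succ_div_eq_sum [DecidableEq ι] {S : Finset ι} {k : ℕ} {f : ι → ℝ}
    (hf : ∀ j ≤ k + 1, 0 < S.esymmOn j f) :
    (k + 2) * (S.esymmOn (k + 2) f / S.esymmOn (k + 1) f) =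
      ∑ i ∈ S, f i * ((S.erase i).esymmOn (k + 1) f / (S.erase i).esymmOn k f) /
        (f i + (S.erase i).esymmOn (k + 1) f / (S.erase i).esymmOn k f) := by
  have h := S.sum_mul_esymmOn_erase (k + 1) f
  push_cast at h
  rw [← mul_div_assoc, show (k + 2 : ℝ) = k + 1 + 1 by ring, ← h, sum_div]
  refine sum_congr rfl fun i hi ↦ ?_
  have hpos := esymmOn_erase_pos hf hi k le_rfl
  have h₁ := hf (k + 1) le_rfl
  rw [esymmOn_succ_eq_erase hi] at h₁ ⊢
  field_simp

/-- The quotients of consecutive elementary symmetric polynomials are superadditive on the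
Gårding cone. -/
theorem esymmOn_div_superadditive (S : Finset ι) (k : ℕ) {f g : ι → ℝ}
    (hf : ∀ j ≤ k, 0 < S.esymmOn j f) (hg : ∀ j ≤ k, 0 < S.esymmOn j g) :
    (∀ j ≤ k, 0 < S.esymmOn j (f + g)) ∧
      S.esymmOn (k + 1) f / S.esymmOn k f + S.esymmOn (k + 1) g / S.esymmOn k g ≤
        S.esymmOn (k + 1) (f + g) / S.esymmOn k (f + g) := by
  classical
  induction k generalizing S with
  | zero => simp [esymmOn_one, sum_add_distrib]
  | succ k ih =>
    obtain ⟨hpos, hle⟩ := ih S (fun j hj ↦ hf j (by omega)) (fun j hj ↦ hg j (by omega))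
    have hpos' : ∀ j ≤ k + 1, 0 < S.esymmOn j (f + g) := by
      intro j hj
      rcases hj.lt_or_eq with hj | rfl
      · exact hpos j (by omega)
      · have h₁ := div_pos (hf (k + 1) le_rfl) (hf k (by omega))
        have h₂ := div_pos (hg (k + 1) le_rfl) (hg k (by omega))
        have h₃ := ((add_pos h₁ h₂).trans_le hle)
        exact (div_pos_iff_of_pos_right (hpos k le_rfl)).1 h₃
    refine ⟨hpos', ?_⟩
    refine le_of_mul_le_mul_left (a := (k + 2 : ℝ)) ?_ (by positivity)
    rw [mul_add, esymmOn_succ_div_eq_sum hf, esymmOn_succ_div_eq_sum hg,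
      esymmOn_succ_div_eq_sum hpos', ← sum_add_distrib]
    refine sum_le_sum fun i hi ↦ ?_
    have add_quot_pos {h : ι → ℝ} (hh : ∀ j ≤ k + 1, 0 < S.esymmOn j h) :
        0 < h i + (S.erase i).esymmOn (k + 1) h / (S.erase i).esymmOn k h := by
      have h₀ := esymmOn_erase_pos hh hi k le_rfl
      have h₁ := hh (k + 1) le_rfl
      rw [esymmOn_succ_eq_erase hi] at h₁
      rw [← mul_div_cancel_right₀ (h i) h₀.ne', ← add_div]
      exact div_pos h₁ h₀
    exact mul_div_add_superadditive (add_quot_pos hf) (add_quot_pos hg)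
      (ih (S.erase i) (esymmOn_erase_pos hf hi) (esymmOn_erase_pos hg hi)).2

theorem prod_range_esymmOn_div (S : Finset ι) (k : ℕ) {f : ι → ℝ}
    (hf : ∀ j ≤ k, 0 < S.esymmOn j f) :
    ∏ j ∈ range k, S.esymmOn (j + 1) f / S.esymmOn j f = S.esymmOn k f := by
  induction k with
  | zero => simp
  | succ k ih =>
    rw [prod_range_succ, ih fun j hj ↦ hf j (by omega)]
    exact mul_div_cancel₀ _ (hf k (by omega)).ne'

/-- The geometric mean is superadditive. -/
theorem prod_rpow_inv_card_superadditive {s : Finset ι} (hs : s.Nonempty) {a b c : ι → ℝ}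
    (ha : ∀ i ∈ s, 0 < a i) (hb : ∀ i ∈ s, 0 < b i) (hc : ∀ i ∈ s, a i + b i ≤ c i) :
    (∏ i ∈ s, a i) ^ (1 / (#s : ℝ)) + (∏ i ∈ s, b i) ^ (1 / (#s : ℝ)) ≤
      (∏ i ∈ s, c i) ^ (1 / (#s : ℝ)) := by
  have hcpos : ∀ i ∈ s, 0 < c i := fun i hi ↦ (add_pos (ha i hi) (hb i hi)).trans_le (hc i hi)
  have hcard : (0 : ℝ) < #s := by exact_mod_cast hs.card_pos
  have key {a : ι → ℝ} (ha : ∀ i ∈ s, 0 < a i) :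
      (∏ i ∈ s, a i) ^ (1 / (#s : ℝ)) / (∏ i ∈ s, c i) ^ (1 / (#s : ℝ)) ≤
        ∑ i ∈ s, 1 / (#s : ℝ) * (a i / c i) := by
    rw [← Real.div_rpow (prod_nonneg fun i hi ↦ (ha i hi).le)
      (prod_nonneg fun i hi ↦ (hcpos i hi).le), ← prod_div_distrib,
      ← Real.finsetProd_rpow _ _ fun i hi ↦ (div_pos (ha i hi) (hcpos i hi)).le]
    refine Real.geom_mean_le_arith_mean_weighted _ _ _ (fun _ _ ↦ by positivity) ?_
      fun i hi ↦ (div_pos (ha i hi) (hcpos i hi)).le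
    simp [hcard.ne']
  have hP : 0 < (∏ i ∈ s, c i) ^ (1 / (#s : ℝ)) := Real.rpow_pos_of_pos (prod_pos hcpos) _
  rw [← div_le_one hP, add_div]
  calc _ ≤ _ := add_le_add (key ha) (key hb)
    _ = ∑ i ∈ s, 1 / (#s : ℝ) * ((a i + b i) / c i) := by
      rw [← sum_add_distrib]
      exact sum_congr rfl fun i _ ↦ by ring
    _ ≤ ∑ i ∈ s, 1 / (#s : ℝ) * 1 := by
      refine sum_le_sum fun i hi ↦ mul_le_mul_of_nonneg_left ?_ (by positivity)
      exact (div_le_one (hcpos i hi)).2 (hc i hi)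
    _ = 1 := by simp [hcard.ne']

theorem esymmOn_rpow_superadditive (S : Finset ι) {k : ℕ} (hk : 1 ≤ k) {f g : ι → ℝ}
    (hf : ∀ j ≤ k, 0 < S.esymmOn j f) (hg : ∀ j ≤ k, 0 < S.esymmOn j g) :
    S.esymmOn k f ^ (1 / (k : ℝ)) + S.esymmOn k g ^ (1 / (k : ℝ)) ≤
      S.esymmOn k (f + g) ^ (1 / (k : ℝ)) := by
  have hfg := (S.esymmOn_div_superadditive k hf hg).1
  have h := prod_rpow_inv_card_superadditive (s := range k) (nonempty_range_iff.2 (by omega))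
    (a := fun j ↦ S.esymmOn (j + 1) f / S.esymmOn j f)
    (b := fun j ↦ S.esymmOn (j + 1) g / S.esymmOn j g)
    (c := fun j ↦ S.esymmOn (j + 1) (f + g) / S.esymmOn j (f + g))
    (fun j hj ↦ by
      have := mem_range.1 hj
      exact div_pos (hf _ (by omega)) (hf _ (by omega)))
    (fun j hj ↦ by
      have := mem_range.1 hj
      exact div_pos (hg _ (by omega)) (hg _ (by omega)))
    (fun j hj ↦ by
      have := mem_range.1 hj
      exact (S.esymmOn_div_superadditive j (fun i hi ↦ hf i (by omega))
        (fun i hi ↦ hg i (by omega))).2)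
  rwa [prod_range_esymmOn_div S k hf, prod_range_esymmOn_div S k hg,
    prod_range_esymmOn_div S k hfg, card_range] at h

theorem esymmOn_smul_rpow (S : Finset ι) {k : ℕ} (hk : 1 ≤ k) {c : ℝ} (hc : 0 ≤ c) {f : ι → ℝ}
    (hf : 0 ≤ S.esymmOn k f) :
    S.esymmOn k (c • f) ^ (1 / (k : ℝ)) = c * S.esymmOn k f ^ (1 / (k : ℝ)) := by
  rw [esymmOn_smul, Real.mul_rpow (by positivity) hf, one_div,
    Real.pow_rpow_inv_natCast hc (by omega)]

end Finset

/-- for `1 ≤ k ≤ n`, the function `λ ↦ σ_k(λ)^{1/k}` is concave on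
`Γ_k`: for all `λ, μ ∈ Γ_k` and `t ∈ [0,1]`,
`σ_k(tλ + (1-t)μ)^{1/k} ≥ t σ_k(λ)^{1/k} + (1-t) σ_k(μ)^{1/k}`. -/
theorem stmt16 (n k : ℕ) (hk : 1 ≤ k) (hkn : k ≤ n)
    (lam mu : Fin n → ℝ) (hlam : lam ∈ GardingCone n k) (hmu : mu ∈ GardingCone n k)
    (t : ℝ) (ht0 : 0 ≤ t) (ht1 : t ≤ 1) :
    (esymm n k (t • lam + (1 - t) • mu)) ^ ((1 : ℝ) / k) ≥
      t * (esymm n k lam) ^ ((1 : ℝ) / k) + (1 - t) * (esymm n k mu) ^ ((1 : ℝ) / k) := by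
  have pos_of_mem {f : Fin n → ℝ} (hf : f ∈ GardingCone n k) :
      ∀ j ≤ k, 0 < (Finset.univ : Finset (Fin n)).esymmOn j f := by
    intro j hj
    rcases Nat.eq_zero_or_pos j with rfl | hj'
    · simp
    · exact hf j hj' hj
  have hl := pos_of_mem hlam
  have hm := pos_of_mem hmu
  rcases ht0.eq_or_lt with rfl | ht0
  · simp
  rcases ht1.eq_or_lt with rfl | ht1
  · simp
  have smul_pos {c : ℝ} (hc : 0 < c) {f : Fin n → ℝ}
      (hf : ∀ j ≤ k, 0 < (Finset.univ : Finset (Fin n)).esymmOn j f) :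
      ∀ j ≤ k, 0 < (Finset.univ : Finset (Fin n)).esymmOn j (c • f) := fun j hj ↦ by
    rw [Finset.esymmOn_smul]
    exact mul_pos (pow_pos hc j) (hf j hj)
  have h := Finset.univ.esymmOn_rpow_superadditive hk (smul_pos ht0 hl)
    (smul_pos (sub_pos.2 ht1) hm)
  rw [Finset.esymmOn_smul_rpow _ hk ht0.le (hl k le_rfl).le,
    Finset.esymmOn_smul_rpow _ hk (sub_pos.2 ht1).le (hm k le_rfl).le] at h
  exact h
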